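/- For all positive integers n and m, the following identity holds in ℤ[x_1,…,x_n,y_1,…,y_m]: ∏_{i=1}^{n} ∏_{a=1}^{m} (1 − x_i y_a) = Σ_λ (−1)^{|λ|} s_λ(x_1,…,x_n) s_{λ'}(y_1,…,y_m), where the sum runs over all partitions λ with ℓ(λ) ≤ n and λ_1 ≤ m (i.e. λ contained in the n×m rectangle), and λ' denotes the conjugate partition. -/

import Mathlib

open MvPolynomial
open scoped Classical

/-- A partition: a weakly decreasing sequence of non-negative integers
with finitely many nonzero parts (indexed from 0). -/
structure Partn where
  parts : ℕ → ℕ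
  antitone : ∀ i j, i ≤ j → parts j ≤ parts i
  eventually_zero : ∃ N, ∀ i, N ≤ i → parts i = 0

namespace Partn

/-- The weight `|λ|` of a partition: the sum of its parts. -/
noncomputable def weight (p : Partn) : ℕ := ∑ᶠ i, p.parts i

/-- `ℓ(λ) ≤ n`: all parts from index `n` on vanish. -/
def LengthLE (p : Partn) (n : ℕ) : Prop := ∀ i, n ≤ i → p.parts i = 0

/-- The parts of the conjugate partition `λ'`:
`λ'_i` is the number of indices `j` with `λ_j > i`. -/
noncomputable def conjParts (p : Partn) (i : ℕ) : ℕ := Nat.card {j : ℕ // i < p.parts j}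

end Partn

/-- The alternant `det(x_i^{l_j + n - j})_{1 ≤ i,j ≤ n}` (indices taken 0-based). -/
noncomputable def alternant (n : ℕ) (l : ℕ → ℕ) : MvPolynomial (Fin n) ℤ :=
  (Matrix.of fun i j : Fin n =>
    (X i : MvPolynomial (Fin n) ℤ) ^ (l (j : ℕ) + (n - 1 - (j : ℕ)))).det

/-- The Vandermonde determinant `det(x_i^{n-j})_{1 ≤ i,j ≤ n}` (0-based). -/
noncomputable def vandermondeP (n : ℕ) : MvPolynomial (Fin n) ℤ :=
  (Matrix.of fun i j : Fin n =>
    (X i : MvPolynomial (Fin n) ℤ) ^ (n - 1 - (j : ℕ))).det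

/-- The Schur polynomial `s_l(x_1,…,x_n)`: the (unique, since `ℤ[x]` is a domain
and the Vandermonde determinant is nonzero) quotient of the alternant by the
Vandermonde determinant, when the latter divides the former. -/
noncomputable def schur (n : ℕ) (l : ℕ → ℕ) : MvPolynomial (Fin n) ℤ :=
  if h : ∃ q : MvPolynomial (Fin n) ℤ, q * vandermondeP n = alternant n l then h.choose else 0

/-- The Littlewood–Richardson coefficient `c^ν_{λμ}`: the coefficient of `s_ν` in the
Schur-basis expansion of `s_λ · s_μ` in `|λ| + |μ|` variables, extracted as the
coefficient of the dominant monomial `x^{ν+ρ}` in `s_λ · s_μ · (Vandermonde)`.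
It is zero unless `|ν| = |λ| + |μ|`. -/
noncomputable def lrCoeff (l m ν : Partn) : ℤ :=
  if ν.weight = l.weight + m.weight then
    MvPolynomial.coeff
      (Finsupp.equivFunOnFinite.symm fun j : Fin (l.weight + m.weight) =>
        ν.parts (j : ℕ) + (l.weight + m.weight - 1 - (j : ℕ)))
      (schur (l.weight + m.weight) l.parts * schur (l.weight + m.weight) m.parts *
        vandermondeP (l.weight + m.weight))
  else 0

theorem conj_iff (p : Partn) (i j : ℕ) : j < p.conjParts i ↔ i < p.parts j := by
  obtain ⟨N, hN⟩ := p.eventually_zero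
  have hex : ∃ k, ¬ i < p.parts k := ⟨N, by simp [hN N le_rfl]⟩
  have key : ∀ j, i < p.parts j ↔ j < Nat.find hex := by
    intro j
    constructor
    · intro h
      by_contra hc
      exact absurd (lt_of_lt_of_le h (p.antitone _ _ (not_lt.1 hc))) (Nat.find_spec hex)
    · intro h
      have := Nat.find_min hex h
      simpa using this
  have : p.conjParts i = Nat.find hex := by
    unfold Partn.conjParts
    rw [Nat.card_congr (Equiv.subtypeEquivRight key)]
    change Nat.card (Set.Iio (Nat.find hex)) = _
    simp
  rw [this, key]

theorem conj_anti (p : Partn) (a b : ℕ) (h : a ≤ b) : p.conjParts b ≤ p.conjParts a := by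
  by_contra hc
  push Not at hc
  rw [conj_iff] at hc
  have : ¬ (p.conjParts a < p.conjParts a) := lt_irrefl _
  rw [conj_iff] at this
  omega

theorem conj_le (p : Partn) (n : ℕ) (hp : p.LengthLE n) (a : ℕ) : p.conjParts a ≤ n := by
  by_contra hc
  push Not at hc
  rw [conj_iff, hp n le_rfl] at hc
  omega

theorem weight_eq (p : Partn) (n : ℕ) (hp : p.LengthLE n) :
    p.weight = ∑ j : Fin n, p.parts j := by
  unfold Partn.weight
  rw [finsum_eq_sum_of_support_subset (s := Finset.range n)]
  · rw [Finset.sum_range]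
  · intro i hi
    simp only [Function.mem_support] at hi
    simp only [Finset.coe_range, Set.mem_Iio]
    by_contra hc
    exact hi (hp i (by omega))

theorem vand_dvd {R : Type*} [CommRing R] (n : ℕ) (x : Fin n → R) (l : Fin n → ℕ) :
    (Matrix.of fun i j : Fin n => x i ^ (n - 1 - (j : ℕ))).det ∣
      (Matrix.of fun i j : Fin n => x i ^ l j).det := by
  rcases subsingleton_or_nontrivial R with hR | hR
  · exact ⟨1, Subsingleton.elim _ _⟩
  let P : Polynomial R := ∏ i, (Polynomial.X - Polynomial.C (x i))
  have hP : P.Monic := Polynomial.monic_prod_of_monic _ _ fun i _ => Polynomial.monic_X_sub_C _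
  have hdeg : P.degree = n := by
    simp only [P]
    rw [Polynomial.degree_prod_of_monic _ _ fun i _ => Polynomial.monic_X_sub_C _]
    simp
  have hev : ∀ i, P.eval (x i) = 0 := by
    intro i
    simp only [P, Polynomial.eval_prod]
    exact Finset.prod_eq_zero (Finset.mem_univ i) (by simp)
  let r : Fin n → Polynomial R := fun j => (Polynomial.X ^ l j) %ₘ P
  have hr : ∀ i j, (r j).eval (x i) = x i ^ l j := by
    intro i j
    have := congrArg (Polynomial.eval (x i))
      (Polynomial.modByMonic_add_div (Polynomial.X ^ l j : Polynomial R) P)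
    simpa [hev i] using this
  have : (Matrix.of fun i j : Fin n => x i ^ l j) =
      (Matrix.of fun i j : Fin n => x i ^ (n - 1 - (j : ℕ))) *
      (Matrix.of fun k j : Fin n => (r j).coeff (n - 1 - (k : ℕ))) := by
    ext i j
    simp only [Matrix.of_apply, Matrix.mul_apply]
    have hd : (r j).degree < n := hdeg ▸ Polynomial.degree_modByMonic_lt _ hP
    have hn : 0 < n := i.pos
    have hd' : (r j).natDegree < n := by
      by_cases h0 : r j = 0
      · simpa [h0] using hn
      · exact (Polynomial.natDegree_lt_iff_degree_lt h0).2 hd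
    rw [← hr, Polynomial.eval_eq_sum_range' hd', Finset.sum_range, ← Equiv.sum_comp Fin.revPerm]
    refine Finset.sum_congr rfl fun k _ => ?_
    have : ((Fin.revPerm k : Fin n) : ℕ) = n - 1 - k := by
      simp [Fin.val_rev]; omega
    rw [this, mul_comm]
  rw [this, Matrix.det_mul]
  exact dvd_mul_right _ _

theorem vand_prod {R : Type*} [CommRing R] (n : ℕ) (x : Fin n → R) :
    (Matrix.of fun i j : Fin n => x i ^ (n - 1 - (j : ℕ))).det =
      ∏ i, ∏ j ∈ Finset.Ioi i, (x i - x j) := by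
  have := Matrix.det_projVandermonde (n := n) (fun _ => (1:R)) x
  simp only [one_mul] at this
  rw [← this]
  congr 1
  ext i j
  simp only [Matrix.of_apply, Matrix.projVandermonde_apply, one_pow, one_mul, Fin.val_rev]
  congr 1; omega

theorem vandermondeP_ne_zero (n : ℕ) : vandermondeP n ≠ 0 := by
  unfold vandermondeP
  rw [vand_prod]
  refine Finset.prod_ne_zero_iff.2 fun i _ => Finset.prod_ne_zero_iff.2 fun j hj => ?_
  rw [sub_ne_zero]
  intro h
  have := MvPolynomial.X_injective h
  simp [this] at hj

theorem schur_mul (n : ℕ) (l : ℕ → ℕ) : schur n l * vandermondeP n = alternant n l := by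
  have h : ∃ q : MvPolynomial (Fin n) ℤ, q * vandermondeP n = alternant n l := by
    obtain ⟨q, hq⟩ := vand_dvd n (fun i => (X i : MvPolynomial (Fin n) ℤ))
      (fun j => l j + (n - 1 - (j : ℕ)))
    exact ⟨q, by rw [mul_comm]; exact hq.symm⟩
  unfold schur
  rw [dif_pos h]
  exact h.choose_spec

/-- Identification of the two blocks of indices with `Fin (n + m)`, the first block reversed. -/
def eqv (n m : ℕ) : Fin n ⊕ Fin m ≃ Fin (n + m) :=
  (Equiv.sumCongr Fin.revPerm (Equiv.refl _)).trans finSumFinEquiv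

theorem eqv_inl (n m : ℕ) (j : Fin n) : (eqv n m (Sum.inl j) : ℕ) = n - 1 - j := by
  simp [eqv, Fin.val_rev]; omega

theorem eqv_inr (n m : ℕ) (a : Fin m) : (eqv n m (Sum.inr a) : ℕ) = n + a := by
  simp [eqv]

/-- Partitions in the `n × m` box. -/
def Box (n m : ℕ) : Type := {p : Partn // p.LengthLE n ∧ p.parts 0 ≤ m}

theorem Box.le {n m : ℕ} (p : Box n m) (j : ℕ) : p.1.parts j ≤ m :=
  (p.1.antitone 0 j (Nat.zero_le _)).trans p.2.2

theorem Box.cle {n m : ℕ} (p : Box n m) (j : ℕ) : p.1.conjParts j ≤ n := conj_le _ _ p.2.1 _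

/-- The shuffle attached to a partition in the box. -/
noncomputable def tauFun {n m : ℕ} (p : Box n m) : Fin n ⊕ Fin m → Fin (n + m)
  | Sum.inl j => ⟨p.1.parts j + (n - 1 - j), by have := p.le j; have := j.2; omega⟩
  | Sum.inr a => ⟨n + a - p.1.conjParts a, by have := a.2; omega⟩

theorem tau_inl {n m : ℕ} (p : Box n m) (j : Fin n) :
    (tauFun p (Sum.inl j) : ℕ) = p.1.parts j + (n - 1 - j) := rfl

theorem tau_inr {n m : ℕ} (p : Box n m) (a : Fin m) :
    (tauFun p (Sum.inr a) : ℕ) = n + a - p.1.conjParts a := rfl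

theorem tau_inl_lt {n m : ℕ} (p : Box n m) (i j : Fin n) (h : i < j) :
    tauFun p (Sum.inl j) < tauFun p (Sum.inl i) := by
  rw [Fin.lt_def, tau_inl, tau_inl]
  have := p.1.antitone i j h.le
  have : (i : ℕ) < j := h
  omega

theorem tau_inr_lt {n m : ℕ} (p : Box n m) (i j : Fin m) (h : i < j) :
    tauFun p (Sum.inr i) < tauFun p (Sum.inr j) := by
  rw [Fin.lt_def, tau_inr, tau_inr]
  have := conj_anti p.1 i j h.le
  have := p.cle i
  have : (i : ℕ) < j := h
  omega

theorem tau_cross {n m : ℕ} (p : Box n m) (i : Fin n) (a : Fin m) :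
    (tauFun p (Sum.inr a) < tauFun p (Sum.inl i) ∧ (a : ℕ) < p.1.parts i) ∨
    (tauFun p (Sum.inl i) < tauFun p (Sum.inr a) ∧ ¬ (a : ℕ) < p.1.parts i) := by
  simp only [Fin.lt_def, tau_inl, tau_inr]
  have := p.cle a
  have := conj_iff p.1 a i
  by_cases h : (a : ℕ) < p.1.parts i
  · have := this.2 h
    omega
  · have : ¬ ((i : ℕ) < p.1.conjParts a) := fun h' => h (this.1 h')
    omega

theorem tau_inj {n m : ℕ} (p : Box n m) : Function.Injective (tauFun p) := by
  rintro (i | a) (j | b) h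
  · rcases lt_trichotomy i j with h' | h' | h'
    · exact absurd h (tau_inl_lt p _ _ h').ne'
    · rw [h']
    · exact absurd h (tau_inl_lt p _ _ h').ne
  · rcases tau_cross p i b with h' | h'
    · exact absurd h h'.1.ne'
    · exact absurd h h'.1.ne
  · rcases tau_cross p j a with h' | h'
    · exact absurd h h'.1.ne
    · exact absurd h h'.1.ne'
  · rcases lt_trichotomy a b with h' | h' | h'
    · exact absurd h (tau_inr_lt p _ _ h').ne
    · rw [h']
    · exact absurd h (tau_inr_lt p _ _ h').ne'

/-- The shuffle as an equivalence. -/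
noncomputable def tau {n m : ℕ} (p : Box n m) : Fin n ⊕ Fin m ≃ Fin (n + m) :=
  Equiv.ofBijective (tauFun p)
    ((Fintype.bijective_iff_injective_and_card _).2 ⟨tau_inj p, by simp⟩)

theorem tau_apply {n m : ℕ} (p : Box n m) (r : Fin n ⊕ Fin m) : tau p r = tauFun p r := rfl

/-- The shuffle as a permutation of the two blocks. -/
noncomputable def sig {n m : ℕ} (p : Box n m) : Equiv.Perm (Fin n ⊕ Fin m) :=
  (tau p).trans (eqv n m).symm

theorem eqv_sig {n m : ℕ} (p : Box n m) (r : Fin n ⊕ Fin m) :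
    eqv n m (sig p r) = tauFun p r := by
  simp [sig, tau_apply]

theorem prod_lt (m k : ℕ) (h : k ≤ m) :
    (∏ a : Fin m, if (a : ℕ) < k then (-1 : ℤˣ) else 1) = (-1) ^ k := by
  rw [Finset.prod_ite]
  simp only [Finset.prod_const]
  rw [Fin.card_filter_val_lt, min_eq_right h]
  simp

theorem sign_sig {n m : ℕ} (p : Box n m) :
    Equiv.Perm.sign (sig p) = (-1 : ℤˣ) ^ p.1.weight := by
  rw [← Equiv.Perm.sign_permCongr (eqv n m), Equiv.Perm.sign_eq_prod_prod_Iio]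
  have h1 : ∀ j : Fin (n + m), ∀ f : Fin (n + m) → ℤˣ,
      ∏ i ∈ Finset.Iio j, f i = ∏ i, if i < j then f i else 1 := by
    intro j f
    rw [← Finset.prod_filter]
    congr 1
    ext; simp
  simp only [h1]
  rw [← Equiv.prod_comp (eqv n m)]
  conv_lhs => enter [2, j]; rw [← Equiv.prod_comp (eqv n m)]
  simp only [Equiv.permCongr_apply, Equiv.symm_apply_apply, eqv_sig, Fintype.prod_sum_type]
  have c1 : ∀ i j : Fin n, (if eqv n m (Sum.inl i) < eqv n m (Sum.inl j) then
      (if tauFun p (Sum.inl i) < tauFun p (Sum.inl j) then (1 : ℤˣ) else -1) else 1) = 1 := by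
    intro i j
    split_ifs with h h' <;> try rfl
    refine absurd (tau_inl_lt p j i ?_) h'
    rw [Fin.lt_def, eqv_inl, eqv_inl] at h
    rw [Fin.lt_def]; omega
  have c2 : ∀ i j : Fin m, (if eqv n m (Sum.inr i) < eqv n m (Sum.inr j) then
      (if tauFun p (Sum.inr i) < tauFun p (Sum.inr j) then (1 : ℤˣ) else -1) else 1) = 1 := by
    intro i j
    split_ifs with h h' <;> try rfl
    refine absurd (tau_inr_lt p i j ?_) h'
    rw [Fin.lt_def, eqv_inr, eqv_inr] at h
    rw [Fin.lt_def]; omega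
  have c3 : ∀ (i : Fin m) (j : Fin n), (if eqv n m (Sum.inr i) < eqv n m (Sum.inl j) then
      (if tauFun p (Sum.inr i) < tauFun p (Sum.inl j) then (1 : ℤˣ) else -1) else 1) = 1 := by
    intro i j
    rw [if_neg]
    rw [Fin.lt_def, eqv_inl, eqv_inr]; omega
  have c4 : ∀ (i : Fin n) (j : Fin m), (if eqv n m (Sum.inl i) < eqv n m (Sum.inr j) then
      (if tauFun p (Sum.inl i) < tauFun p (Sum.inr j) then (1 : ℤˣ) else -1) else 1) =
      if (j : ℕ) < p.1.parts i then -1 else 1 := by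
    intro i j
    rw [if_pos (by rw [Fin.lt_def, eqv_inl, eqv_inr]; omega)]
    rcases tau_cross p i j with h | h
    · rw [if_neg h.1.asymm, if_pos h.2]
    · rw [if_pos h.1, if_neg h.2]
  simp only [c1, c2, c3, c4, Finset.prod_const_one, mul_one, one_mul]
  rw [Finset.prod_comm]
  simp only [prod_lt _ _ (p.le _)]
  rw [Finset.prod_pow_eq_pow_sum, weight_eq _ n p.2.1]

/-- The full parametrisation of permutations by shuffles and block permutations. -/
noncomputable def big (n m : ℕ) (t : Box n m × Equiv.Perm (Fin n) × Equiv.Perm (Fin m)) :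
    Equiv.Perm (Fin n ⊕ Fin m) := sig t.1 * Equiv.Perm.sumCongr t.2.1 t.2.2

theorem Box.ext' {n m : ℕ} (p q : Box n m) (h : ∀ j : Fin n, p.1.parts j = q.1.parts j) :
    p = q := by
  apply Subtype.ext
  have : p.1.parts = q.1.parts := by
    funext j
    by_cases hj : j < n
    · exact h ⟨j, hj⟩
    · rw [p.2.1 j (by omega), q.2.1 j (by omega)]
  rcases p with ⟨⟨a, b, c⟩, d⟩
  rcases q with ⟨⟨a', b', c'⟩, d'⟩
  simp only at this
  subst this
  rfl

theorem big_inj (n m : ℕ) : Function.Injective (big n m) := by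
  rintro ⟨p, α, β⟩ ⟨q, α', β'⟩ h
  have hval : ∀ i : Fin n, tauFun p (Sum.inl (α i)) = tauFun q (Sum.inl (α' i)) := by
    intro i
    have := congrArg (fun s => eqv n m (s (Sum.inl i))) h
    simpa [big, eqv_sig] using this
  have hr : (fun i : Fin n => tauFun p (Sum.inl i.rev)) = fun i => tauFun q (Sum.inl i.rev) := by
    refine (StrictMono.range_inj ?_ ?_).1 ?_
    · intro i j hij
      exact tau_inl_lt p _ _ (Fin.rev_lt_rev.2 hij)
    · intro i j hij
      exact tau_inl_lt q _ _ (Fin.rev_lt_rev.2 hij)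
    · ext k
      constructor
      · rintro ⟨i, rfl⟩
        refine ⟨(α' (α.symm i.rev)).rev, ?_⟩
        have := hval (α.symm i.rev)
        simpa using this.symm
      · rintro ⟨i, rfl⟩
        refine ⟨(α (α'.symm i.rev)).rev, ?_⟩
        have := hval (α'.symm i.rev)
        simpa using this
  have hpq : p = q := by
    apply Box.ext'
    intro j
    have := congrArg Fin.val (congrFun hr j.rev)
    simp only [Fin.rev_rev, tau_inl] at this
    omega
  subst hpq
  have h2 : Equiv.Perm.sumCongrHom _ _ (α, β) = Equiv.Perm.sumCongrHom _ _ (α', β') :=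
    mul_left_cancel (a := sig p) h
  have h3 := Equiv.Perm.sumCongrHom_injective h2
  rw [h3]

theorem big_surj (n m : ℕ) : Function.Surjective (big n m) := by
  intro σ
  let f : Fin n → Fin (n + m) := fun i => eqv n m (σ (Sum.inl i))
  have hf : Function.Injective f := fun i j h => by simpa [f] using h
  let S : Finset (Fin (n + m)) := Finset.univ.image f
  have hS : S.card = n := by
    rw [Finset.card_image_of_injective _ hf]; simp
  let g : Fin n ↪o Fin (n + m) := S.orderEmbOfFin hS
  have hgm : ∀ i j : Fin n, i ≤ j → (g i : ℕ) + (j - i) ≤ g j := by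
    intro i j hij
    obtain ⟨d, hd⟩ : ∃ d, (j : ℕ) = i + d := ⟨j - i, by have : (i:ℕ) ≤ j := hij; omega⟩
    induction d generalizing j with
    | zero =>
      have : j = i := Fin.ext (by omega)
      simp [this]
    | succ d ih =>
      have hj := j.2
      have h1 := ih ⟨i + d, by omega⟩ (by rw [Fin.le_def]; simp) rfl
      have h2 : g ⟨i + d, by omega⟩ < g j := g.strictMono (by rw [Fin.lt_def]; simp; omega)
      rw [Fin.lt_def] at h2
      simp only at h1
      omega
  have hg0 : ∀ j : Fin n, (j : ℕ) ≤ g j := by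
    intro j
    have := hgm ⟨0, j.pos⟩ j (by rw [Fin.le_def]; simp)
    simp only at this
    omega
  let lam : ℕ → ℕ := fun j => if h : j < n then (g (Fin.rev ⟨j, h⟩) : ℕ) - (n - 1 - j) else 0
  let p : Partn := ⟨lam, by
    intro i j hij
    simp only [lam]
    split_ifs with h1 h2
    · have := hgm (Fin.rev ⟨j, h1⟩) (Fin.rev ⟨i, h2⟩) (by rw [Fin.le_def]; simp [Fin.val_rev]; omega)
      simp only [Fin.val_rev] at this
      omega
    · omega
    · omega
    · omega, ⟨n, fun i hi => by simp [lam]; omega⟩⟩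
  have hp1 : p.LengthLE n := fun i hi => by
    simp only [p, lam]; rw [dif_neg (by omega)]
  have hp2 : p.parts 0 ≤ m := by
    simp only [p, lam]
    split_ifs with h
    · have := (g (Fin.rev ⟨0, h⟩)).2
      omega
    · omega
  let P : Box n m := ⟨p, hp1, hp2⟩
  have htau : ∀ j : Fin n, tauFun P (Sum.inl j) = g j.rev := by
    intro j
    apply Fin.ext
    rw [tau_inl]
    have h1 : P.1.parts j = (g j.rev : ℕ) - (n - 1 - j) := by
      simp only [P, p, lam]
      rw [dif_pos j.2]
    have := hg0 j.rev
    rw [Fin.val_rev] at this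
    omega
  have hmaps : Set.MapsTo ((sig P)⁻¹ * σ : Equiv.Perm (Fin n ⊕ Fin m))
      (Set.range Sum.inl) (Set.range Sum.inl) := by
    rintro _ ⟨i, rfl⟩
    have hmem : f i ∈ Set.range g := by
      simp only [g, Finset.range_orderEmbOfFin]
      simp [S]
    obtain ⟨j, hj⟩ := hmem
    refine ⟨j.rev, ?_⟩
    rw [Equiv.Perm.mul_apply, Equiv.Perm.eq_inv_iff_eq]
    apply (eqv n m).injective
    rw [eqv_sig, htau, Fin.rev_rev, hj]
  obtain ⟨⟨α, β⟩, hab⟩ := Equiv.Perm.mem_sumCongrHom_range_of_perm_mapsTo_inl hmaps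
  refine ⟨(P, α, β), ?_⟩
  have : Equiv.Perm.sumCongr α β = (sig P)⁻¹ * σ := hab
  simp only [big]
  rw [this, mul_inv_cancel_left]

noncomputable instance (n m : ℕ) : Fintype (Box n m) :=
  @Fintype.ofFinite _ (Finite.of_injective (fun p : Box n m => big n m (p, 1, 1)) (by
    intro p q h
    exact congrArg Prod.fst (big_inj n m h)))

theorem det_prod {R : Type*} [CommRing R] (n m : ℕ) (x : Fin n → R) (y : Fin m → R) :
    (Matrix.projVandermonde (fun k => Sum.elim x 1 ((eqv n m).symm k))
      (fun k => Sum.elim 1 y ((eqv n m).symm k))).det =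
    (∏ i, ∏ a, (1 - x i * y a)) *
    ((Matrix.of fun i j : Fin n => x i ^ (n - 1 - (j : ℕ))).det *
     (Matrix.of fun i j : Fin m => y i ^ (m - 1 - (j : ℕ))).det) := by
  have h1 : ∀ N : ℕ, ∀ j : Fin N, ∀ f : Fin N → R,
      ∏ i ∈ Finset.Ioi j, f i = ∏ i, if j < i then f i else 1 := by
    intro N j f
    rw [← Finset.prod_filter]
    congr 1
    ext; simp
  rw [Matrix.det_projVandermonde, vand_prod, vand_prod]
  simp only [h1]
  rw [← Equiv.prod_comp (eqv n m)]
  conv_lhs => enter [2, j]; rw [← Equiv.prod_comp (eqv n m)]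
  simp only [Equiv.symm_apply_apply, Fintype.prod_sum_type, Sum.elim_inl, Sum.elim_inr,
    Fin.lt_def, eqv_inl, eqv_inr, Pi.one_apply, mul_one, one_mul]
  have e1 : ∀ (i : Fin n) (j : Fin n), (n - 1 - (i : ℕ) < n - 1 - j) ↔ j < i := by
    intro i j; rw [Fin.lt_def]; omega
  have e2 : ∀ (i : Fin n) (j : Fin m), (n - 1 - (i : ℕ) < n + j) := by
    intro i j; omega
  have e3 : ∀ (i : Fin m) (j : Fin n), ¬ (n + (i : ℕ) < n - 1 - j) := by
    intro i j; omega
  simp only [e1, e2, e3, if_true, if_false, Finset.prod_const_one, one_mul, add_lt_add_iff_left,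
    Finset.prod_mul_distrib, ← Fin.lt_def]
  rw [Finset.prod_comm (f := fun i j : Fin n => if j < i then x j - x i else 1)]
  ring

theorem det_sum {R : Type*} [CommRing R] (n m : ℕ) (x : Fin n → R) (y : Fin m → R) :
    (Matrix.projVandermonde (fun k => Sum.elim x 1 ((eqv n m).symm k))
      (fun k => Sum.elim 1 y ((eqv n m).symm k))).det =
    ∑ p : Box n m, ((-1 : ℤ) ^ p.1.weight) •
    ((Matrix.of fun i j : Fin n => x i ^ (p.1.parts j + (n - 1 - (j : ℕ)))).det *
     (Matrix.of fun i j : Fin m => y i ^ (p.1.conjParts j + (m - 1 - (j : ℕ)))).det) := by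
  rw [← Matrix.det_submatrix_equiv_self (eqv n m), ← Matrix.det_transpose, Matrix.det_apply',
    ← Function.Bijective.sum_comp ⟨big_inj n m, big_surj n m⟩, Fintype.sum_prod_type]
  refine Finset.sum_congr rfl fun p _ => ?_
  rw [Fintype.sum_prod_type]
  conv_rhs => rw [← Matrix.det_transpose, ← Matrix.det_transpose (Matrix.of fun i j : Fin m => _),
    Matrix.det_apply', Matrix.det_apply', Finset.sum_mul_sum, Finset.smul_sum]
  refine Finset.sum_congr rfl fun α _ => ?_
  rw [Finset.smul_sum]
  refine Finset.sum_congr rfl fun β _ => ?_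
  have hy : ∀ a : Fin m, n + m - (n + (a : ℕ) - p.1.conjParts a + 1) =
      p.1.conjParts a + (m - 1 - a) := by
    intro a
    have := p.cle a
    omega
  simp only [big, Equiv.Perm.sign_mul, Equiv.Perm.sign_sumCongr, sign_sig, Fintype.prod_sum_type,
    Matrix.transpose_apply, Matrix.submatrix_apply, Matrix.projVandermonde_apply,
    Equiv.Perm.mul_apply, Equiv.Perm.sumCongr_apply, Sum.map_inl, Sum.map_inr, eqv_sig,
    Equiv.symm_apply_apply, Sum.elim_inl, Sum.elim_inr, Pi.one_apply, one_pow, mul_one, one_mul,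
    Fin.val_rev, tau_inl, tau_inr, hy, Matrix.of_apply, zsmul_eq_mul]
  push_cast
  ring

theorem rename_det {k : ℕ} {τ : Type*} (f : Fin k → τ) (l : Fin k → ℕ) :
    rename f (Matrix.of fun i j : Fin k => (X i : MvPolynomial (Fin k) ℤ) ^ l j).det =
      (Matrix.of fun i j : Fin k => (X (f i) : MvPolynomial τ ℤ) ^ l j).det := by
  rw [AlgHom.map_det]
  congr 1
  ext1 i j
  simp

theorem rename_vand {k : ℕ} {τ : Type*} (f : Fin k → τ) :
    rename f (vandermondeP k) =
      (Matrix.of fun i j : Fin k => (X (f i) : MvPolynomial τ ℤ) ^ (k - 1 - (j : ℕ))).det :=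
  rename_det f _

theorem rename_alt {k : ℕ} {τ : Type*} (f : Fin k → τ) (l : ℕ → ℕ) :
    (Matrix.of fun i j : Fin k =>
        (X (f i) : MvPolynomial τ ℤ) ^ (l j + (k - 1 - (j : ℕ)))).det =
      rename f (schur k l) * rename f (vandermondeP k) := by
  rw [← map_mul, schur_mul]
  exact (rename_det f _).symm

theorem finsum_box (n m : ℕ) {M : Type*} [AddCommMonoid M] (F : Partn → M) :
    ∑ᶠ (p : Partn) (_ : p.LengthLE n ∧ p.parts 0 ≤ m), F p = ∑ p : Box n m, F p.1 := by
  have hfs := finsum_subtype_eq_finsum_cond (f := F) (fun p => p.LengthLE n ∧ p.parts 0 ≤ m)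
  refine hfs.symm.trans ?_
  exact finsum_eq_sum_of_fintype (fun p : Box n m => F p.1)

theorem dual_cauchy_core {R : Type*} [CommRing R] [IsDomain R] (n m : ℕ)
    (x : Fin n → R) (y : Fin m → R) (V W : R) (hV : V ≠ 0) (hW : W ≠ 0) (A B : Box n m → R)
    (hV' : V = (Matrix.of fun i j : Fin n => x i ^ (n - 1 - (j : ℕ))).det)
    (hW' : W = (Matrix.of fun i j : Fin m => y i ^ (m - 1 - (j : ℕ))).det)
    (hA : ∀ p : Box n m,
      (Matrix.of fun i j : Fin n => x i ^ (p.1.parts j + (n - 1 - (j : ℕ)))).det = A p * V)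
    (hB : ∀ p : Box n m,
      (Matrix.of fun i j : Fin m => y i ^ (p.1.conjParts j + (m - 1 - (j : ℕ)))).det = B p * W) :
    (∏ i, ∏ a, (1 - x i * y a)) = ∑ p : Box n m, ((-1 : ℤ) ^ p.1.weight) • (A p * B p) := by
  have key := (det_prod n m x y).symm.trans (det_sum n m x y)
  rw [← hV', ← hW'] at key
  simp only [hA, hB] at key
  apply mul_right_cancel₀ (mul_ne_zero hV hW)
  rw [key, Finset.sum_mul]
  refine Finset.sum_congr rfl fun p _ => ?_
  rw [smul_mul_assoc]
  congr 1
  ring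

theorem dual_cauchy_box (n m : ℕ) :
    (∏ i : Fin n, ∏ a : Fin m,
        (1 - X (Sum.inl i) * X (Sum.inr a) : MvPolynomial (Fin n ⊕ Fin m) ℤ)) =
    ∑ p : Box n m, ((-1 : ℤ) ^ p.1.weight) •
        (rename Sum.inl (schur n p.1.parts) * rename Sum.inr (schur m p.1.conjParts)) := by
  have hV1 : (rename Sum.inl (vandermondeP n) : MvPolynomial (Fin n ⊕ Fin m) ℤ) ≠ 0 := by
    rw [Ne, map_eq_zero_iff _ (rename_injective _ Sum.inl_injective)]
    exact vandermondeP_ne_zero n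
  have hV2 : (rename Sum.inr (vandermondeP m) : MvPolynomial (Fin n ⊕ Fin m) ℤ) ≠ 0 := by
    rw [Ne, map_eq_zero_iff _ (rename_injective _ Sum.inr_injective)]
    exact vandermondeP_ne_zero m
  exact dual_cauchy_core n m (fun i => X (Sum.inl i)) (fun a => X (Sum.inr a))
    (rename Sum.inl (vandermondeP n)) (rename Sum.inr (vandermondeP m)) hV1 hV2
    (fun p => rename Sum.inl (schur n p.1.parts)) (fun p => rename Sum.inr (schur m p.1.conjParts))
    (rename_vand _) (rename_vand _) (fun p => rename_alt _ _) (fun p => rename_alt _ _)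

theorem dual_cauchy (n m : ℕ) (hn : 0 < n) (hm : 0 < m) :
    (∏ i : Fin n, ∏ a : Fin m,
        (1 - X (Sum.inl i) * X (Sum.inr a) : MvPolynomial (Fin n ⊕ Fin m) ℤ)) =
    ∑ᶠ (p : Partn) (_ : p.LengthLE n ∧ p.parts 0 ≤ m),
      ((-1 : ℤ) ^ p.weight) •
        (rename Sum.inl (schur n p.parts) * rename Sum.inr (schur m p.conjParts)) := by
  rw [finsum_box]
  exact dual_cauchy_box n m
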